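/- Fix q ∈ (0,1), m ≥ 1, and x, y ∈ W_m with y_i ∈ {x_i − 1, x_i} for every i. For each sufficiently large N, let λ_1 ≥ … ≥ λ_N and μ_1 ≥ … ≥ μ_{N−1} be the unique partitions determined by the conditions {λ_1−1, λ_2−2, …, λ_N−N} = {0,1,…,N+m−1} ∖ {x_1,…,x_m} and {μ_1−1, μ_2−2, …, μ_{N−1}−(N−1)} = {1,2,…,N+m−1} ∖ {y_1+1,…,y_m+1} (as sets), and define R_N = q^{(N−1)(|λ|−|μ|)} · [ ∏_{1≤i<j≤N−1} (q^{μ_i−i}−q^{μ_j−j})/(q^{−i}−q^{−j}) ] / [ ∏_{1≤i<j≤N} (q^{λ_i−i}−q^{λ_j−j})/(q^{−i}−q^{−j}) ], where |λ| = λ_1+…+λ_N and |μ| = μ_1+…+μ_{N−1}. Then lim_{N→+∞} R_N = Υ_m(x,y). (The two Vandermonde-type products are the principal specializations s_μ(1,q,…,q^{N−2}) and s_λ(1,q,…,q^{N−1}) of Schur polynomials, so R_N is the probability that the q^{−volume}-distributed lozenge tiling with top row λ has second row μ.) -/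

import Mathlib

/-- `W_m = {x₁ > x₂ > … > x_m ≥ 0}`. -/
def Wm (m : ℕ) (x : Fin m → ℤ) : Prop := StrictAnti x ∧ ∀ i, 0 ≤ x i

/-- Transition matrix of `m` independent `q`-exchangeable walks. -/
noncomputable def UpsInd (q : ℝ) (m : ℕ) (x y : Fin m → ℤ) : ℝ :=
  ∏ i : Fin m, (q ^ (x i) * (if y i = x i then 1 else 0)
    + (1 - q ^ (x i)) * (if y i = x i - 1 then 1 else 0))

/-- The noncolliding `q`-exchangeable walk transition matrix `Υ_m`. -/
noncomputable def UpsM (q : ℝ) (m : ℕ) (x y : Fin m → ℤ) : ℝ :=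
  q ^ (-((m : ℤ) * ((m : ℤ) - 1) / 2) + ((m : ℤ) - 1) * ((∑ i, x i) - ∑ i, y i)) *
    (∏ i : Fin m, ∏ j ∈ Finset.Ioi i, (q ^ (y j) - q ^ (y i)) / (q ^ (x j) - q ^ (x i))) *
    UpsInd q m x y


/-- The product of `|q ^ a - q ^ b|` over the unordered pairs of a finite set of integers. -/
noncomputable def pairProd (q : ℝ) (S : Finset ℤ) : ℝ :=
  ∏ a ∈ S, ∏ b ∈ S, if a < b then |q ^ a - q ^ b| else 1

/-- The product of `|q ^ x - q ^ a|` over the elements `a ≠ x` of a finite set of integers. -/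
noncomputable def pointProd (q : ℝ) (S : Finset ℤ) (x : ℤ) : ℝ :=
  ∏ a ∈ S.erase x, |q ^ x - q ^ a|

theorem pairProd_insert (q : ℝ) {S : Finset ℤ} {a : ℤ} (ha : a ∉ S) :
    pairProd q (insert a S) = (∏ b ∈ S, |q ^ a - q ^ b|) * pairProd q S := by
  unfold pairProd
  simp only [Finset.prod_insert ha, lt_irrefl, if_false, one_mul, Finset.prod_mul_distrib]
  rw [← mul_assoc, ← Finset.prod_mul_distrib]
  congr 1
  refine Finset.prod_congr rfl fun b hb => ?_
  have hne : a ≠ b := fun h => ha (h ▸ hb)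
  rcases lt_or_gt_of_ne hne with h | h
  · simp [h, h.le]
  · simp [h, h.le, abs_sub_comm]

theorem abs_zpow_sub_pos {q : ℝ} (hq0 : 0 < q) (hq1 : q < 1) {a b : ℤ} (h : a ≠ b) :
    0 < |q ^ a - q ^ b| :=
  abs_pos.2 (sub_ne_zero.2 fun e => h ((zpow_right_injective₀ hq0 hq1.ne) e))

theorem pairProd_pos {q : ℝ} (hq0 : 0 < q) (hq1 : q < 1) (S : Finset ℤ) : 0 < pairProd q S := by
  refine Finset.prod_pos fun a _ => Finset.prod_pos fun b _ => ?_
  split_ifs with h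
  · exact abs_zpow_sub_pos hq0 hq1 h.ne
  · exact one_pos

theorem pointProd_pos {q : ℝ} (hq0 : 0 < q) (hq1 : q < 1) (S : Finset ℤ) (x : ℤ) :
    0 < pointProd q S x :=
  Finset.prod_pos fun _ ha => abs_zpow_sub_pos hq0 hq1 (Finset.ne_of_mem_erase ha).symm

theorem pairProd_sdiff_mul (q : ℝ) {A X : Finset ℤ} (h : X ⊆ A) :
    pairProd q (A \ X) * ∏ x ∈ X, pointProd q A x = pairProd q A * pairProd q X := by
  induction X using Finset.induction_on with
  | empty => simp [pairProd]
  | insert x X hx ih =>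
    have hxA : x ∈ A := h (Finset.mem_insert_self _ _)
    have hXA : X ⊆ A := (Finset.subset_insert _ _).trans h
    have e1 : A \ X = insert x (A \ insert x X) := by
      ext a; by_cases hax : a = x <;> simp_all
    have e2 : A.erase x = (A \ insert x X) ∪ X := by
      ext a
      have := @hXA a
      by_cases hax : a = x
      · simp_all
      · simp [hax]; tauto
    have hd : Disjoint (A \ insert x X) X :=
      Finset.disjoint_left.2 fun a ha hb =>
        (Finset.mem_sdiff.1 ha).2 (Finset.mem_insert_of_mem hb)
    have ih := ih hXA
    rw [e1, pairProd_insert q (by simp)] at ih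
    rw [Finset.prod_insert hx, pairProd_insert q hx, pointProd, e2, Finset.prod_union hd]
    linear_combination (∏ b ∈ X, |q ^ x - q ^ b|) * ih

theorem prod_Ioi_eq_pairProd (q : ℝ) {n : ℕ} {f : Fin n → ℤ} (hf : StrictAnti f) :
    ∏ i, ∏ j ∈ Finset.Ioi i, |q ^ f i - q ^ f j| = pairProd q (Finset.image f Finset.univ) := by
  unfold pairProd
  simp only [Finset.prod_image hf.injective.injOn, hf.lt_iff_gt]
  rw [Finset.prod_comm]
  refine Finset.prod_congr rfl fun i _ => ?_
  rw [← Finset.prod_filter]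
  refine Finset.prod_congr (by ext; simp) fun j _ => abs_sub_comm _ _

theorem prod_Ioi_div {q : ℝ} (hq0 : 0 < q) (hq1 : q < 1) {n : ℕ} {f g : Fin n → ℤ}
    (hf : StrictAnti f) (hg : StrictAnti g) :
    ∏ i, ∏ j ∈ Finset.Ioi i, (q ^ f i - q ^ f j) / (q ^ g i - q ^ g j) =
      pairProd q (Finset.image f Finset.univ) / pairProd q (Finset.image g Finset.univ) := by
  rw [← prod_Ioi_eq_pairProd q hf, ← prod_Ioi_eq_pairProd q hg]
  simp only [← Finset.prod_div_distrib]
  refine Finset.prod_congr rfl fun i _ => Finset.prod_congr rfl fun j hj => ?_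
  have hij := Finset.mem_Ioi.1 hj
  have h1 := zpow_lt_zpow_right_of_lt_one₀ hq0 hq1 (hf hij)
  have h2 := zpow_lt_zpow_right_of_lt_one₀ hq0 hq1 (hg hij)
  rw [abs_of_neg (sub_neg.2 h1), abs_of_neg (sub_neg.2 h2), neg_div_neg_eq]

theorem prod_zpow_eq_zpow_sum {ι : Type*} {q : ℝ} (hq : q ≠ 0) (s : Finset ι) (f : ι → ℤ) :
    ∏ i ∈ s, q ^ f i = q ^ ∑ i ∈ s, f i := by
  classical
  induction s using Finset.induction_on with
  | empty => simp
  | insert a s ha ih => rw [Finset.prod_insert ha, Finset.sum_insert ha, zpow_add₀ hq, ih]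

theorem sum_card_Ioi (m : ℕ) :
    ∑ i : Fin m, ∑ _j ∈ Finset.Ioi i, (1 : ℤ) = (m : ℤ) * ((m : ℤ) - 1) / 2 := by
  have h : ∑ i : Fin m, ∑ _j ∈ Finset.Ioi i, (1 : ℤ) = ((∑ i ∈ Finset.range m, i : ℕ) : ℤ) := by
    rw [← Finset.sum_range_reflect, ← Fin.sum_univ_eq_sum_range (fun i => m - 1 - i)]
    simp
  have h2 := Finset.sum_range_id_mul_two m
  rw [h]
  have h3 : ((∑ i ∈ Finset.range m, i : ℕ) : ℤ) * 2 = (m : ℤ) * ((m : ℤ) - 1) := by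
    rcases m with _ | m
    · simp
    · have := congrArg (fun k : ℕ => (k : ℤ)) h2
      push_cast at this ⊢
      simpa using this
  omega

theorem pairProd_image_add_one {q : ℝ} (hq0 : 0 < q) {m : ℕ} {y : Fin m → ℤ}
    (hy : StrictAnti y) :
    pairProd q (Finset.image (fun r => y r + 1) Finset.univ) =
      q ^ ((m : ℤ) * ((m : ℤ) - 1) / 2) * pairProd q (Finset.image y Finset.univ) := by
  rw [← prod_Ioi_eq_pairProd q hy, ← prod_Ioi_eq_pairProd q (hy.add_const 1), ← sum_card_Ioi,
    ← prod_zpow_eq_zpow_sum hq0.ne', ← Finset.prod_mul_distrib]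
  refine Finset.prod_congr rfl fun i _ => ?_
  rw [← prod_zpow_eq_zpow_sum hq0.ne', ← Finset.prod_mul_distrib]
  refine Finset.prod_congr rfl fun j _ => ?_
  rw [zpow_add_one₀ hq0.ne', zpow_add_one₀ hq0.ne', ← sub_mul, abs_mul, abs_of_pos hq0, zpow_one,
    mul_comm]

theorem pointProd_Icc_zero_of_pos {q : ℝ} (hq0 : 0 < q) (hq1 : q < 1) {K x : ℤ} (hx : 0 < x)
    (hK : 0 ≤ K) :
    pointProd q (Finset.Icc 0 K) x = (1 - q ^ x) * pointProd q (Finset.Icc 1 K) x := by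
  unfold pointProd
  have e : (Finset.Icc 0 K).erase x = insert 0 ((Finset.Icc 1 K).erase x) := by
    ext a; simp only [Finset.mem_erase, Finset.mem_insert, Finset.mem_Icc]; omega
  rw [e, Finset.prod_insert (by simp), zpow_zero, abs_sub_comm, abs_of_pos]
  exact sub_pos.2 (zpow_lt_one₀ hq0 hq1 hx)

theorem pointProd_Icc_zero_succ {q : ℝ} (hq0 : 0 < q) (hq1 : q < 1) {K x : ℤ} (hx : 0 ≤ x)
    (hK : x < K) :
    pointProd q (Finset.Icc 0 K) x =
      q ^ x * (1 - q ^ (K - x)) * q ^ (-(K - 1)) * pointProd q (Finset.Icc 1 K) (x + 1) := by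
  unfold pointProd
  have e : (Finset.Icc 0 K).erase x = insert K ((Finset.Ico 0 K).erase x) := by
    ext a; simp only [Finset.mem_erase, Finset.mem_insert, Finset.mem_Icc, Finset.mem_Ico]; omega
  have e2 : (Finset.Icc 1 K).erase (x + 1) = ((Finset.Ico 0 K).erase x).image (· + 1) := by
    ext a
    simp only [Finset.mem_erase, Finset.mem_Icc, Finset.mem_Ico, Finset.mem_image]
    constructor
    · intro h; exact ⟨a - 1, by omega, by omega⟩
    · rintro ⟨b, h, rfl⟩; omega
  have hcard : (((Finset.Ico 0 K).erase x).card : ℤ) = K - 1 := by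
    rw [Finset.card_erase_of_mem (by simp; omega), Int.card_Ico]; omega
  have h3 : ∏ a ∈ (Finset.Icc 1 K).erase (x + 1), |q ^ (x + 1) - q ^ a| =
      q ^ (K - 1) * ∏ a ∈ (Finset.Ico 0 K).erase x, |q ^ x - q ^ a| := by
    rw [e2, Finset.prod_image (fun a _ b _ h => by simpa using h), ← hcard, zpow_natCast,
      ← Finset.prod_const, ← Finset.prod_mul_distrib]
    refine Finset.prod_congr rfl fun j _ => ?_
    rw [zpow_add_one₀ hq0.ne', zpow_add_one₀ hq0.ne', ← sub_mul, abs_mul, abs_of_pos hq0, mul_comm]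
  have h4 : |q ^ x - q ^ K| = q ^ x * (1 - q ^ (K - x)) := by
    rw [abs_of_pos (sub_pos.2 (zpow_lt_zpow_right_of_lt_one₀ hq0 hq1 hK)), mul_sub,
      ← zpow_add₀ hq0.ne']
    simp
  rw [e, Finset.prod_insert (by simp), h3, h4, zpow_neg]
  have := (zpow_pos hq0 (K - 1)).ne'
  field_simp

theorem pairProd_Icc_zero {q : ℝ} (hq0 : 0 < q) (hq1 : q < 1) {K : ℤ} (hK : 0 ≤ K) :
    pairProd q (Finset.Icc 0 K) =
      (∏ a ∈ Finset.Icc 1 K, (1 - q ^ a)) * pairProd q (Finset.Icc 1 K) := by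
  have e : Finset.Icc 0 K = insert 0 (Finset.Icc 1 K) := by
    ext a; simp only [Finset.mem_insert, Finset.mem_Icc]; omega
  rw [e, pairProd_insert q (by simp)]
  congr 1
  refine Finset.prod_congr rfl fun a ha => ?_
  rw [zpow_zero, abs_of_pos]
  exact sub_pos.2 (zpow_lt_one₀ hq0 hq1 (by have := Finset.mem_Icc.1 ha; omega))

theorem image_neg_sub_one (n : ℕ) :
    Finset.image (fun i : Fin n => -(i : ℤ) - 1) Finset.univ = Finset.Ico (-(n : ℤ)) 0 := by
  ext a
  simp only [Finset.mem_image, Finset.mem_univ, true_and, Finset.mem_Ico]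
  constructor
  · rintro ⟨i, rfl⟩; omega
  · intro h; exact ⟨⟨(-a - 1).toNat, by omega⟩, by simp; omega⟩

theorem pairProd_Ico_neg {q : ℝ} (hq0 : 0 < q) (hq1 : q < 1) {n : ℤ} (hn : 1 ≤ n) :
    pairProd q (Finset.Ico (-n) 0) =
      q ^ (-(n * (n - 1))) * (∏ a ∈ Finset.Icc 1 (n - 1), (1 - q ^ a)) *
        pairProd q (Finset.Ico (-(n - 1)) 0) := by
  have e : Finset.Ico (-n) 0 = insert (-n) (Finset.Ico (-(n - 1)) 0) := by
    ext a; simp only [Finset.mem_insert, Finset.mem_Ico]; omega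
  have e2 : Finset.Ico (-(n - 1)) 0 = (Finset.Icc 1 (n - 1)).image (· - n) := by
    ext a
    simp only [Finset.mem_Icc, Finset.mem_Ico, Finset.mem_image]
    constructor
    · intro h; exact ⟨a + n, by omega, by omega⟩
    · rintro ⟨b, h, rfl⟩; omega
  have h : ∏ b ∈ Finset.Ico (-(n - 1)) 0, |q ^ (-n) - q ^ b| =
      q ^ (-(n * (n - 1))) * ∏ a ∈ Finset.Icc 1 (n - 1), (1 - q ^ a) := by
    have hc : ((Finset.Icc 1 (n - 1)).card : ℤ) = n - 1 := by simp; omega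
    have : -(n * (n - 1)) = ∑ _a ∈ Finset.Icc 1 (n - 1), (-n) := by
      rw [Finset.sum_const, nsmul_eq_mul, hc]; ring
    rw [e2, Finset.prod_image (fun a _ b _ h => by simpa using h), this,
      ← prod_zpow_eq_zpow_sum hq0.ne', ← Finset.prod_mul_distrib]
    refine Finset.prod_congr rfl fun a ha => ?_
    have ha := (Finset.mem_Icc.1 ha).1
    rw [sub_eq_neg_add a n, zpow_add₀ hq0.ne', ← mul_one_sub, abs_mul,
      abs_of_pos (zpow_pos hq0 _), abs_of_pos]
    exact sub_pos.2 (zpow_lt_one₀ hq0 hq1 (by omega))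
  rw [e, pairProd_insert q (by simp), h]

theorem sum_sub_sum_of_image {m n : ℕ} {x y : Fin m → ℤ} {lam : Fin (n + 1) → ℤ} {mu : Fin n → ℤ}
    (hx : Function.Injective x) (hy : Function.Injective y)
    (hxA : Finset.image x Finset.univ ⊆ Finset.Icc 0 ((n : ℤ) + m))
    (hyB : Finset.image (fun r => y r + 1) Finset.univ ⊆ Finset.Icc 1 ((n : ℤ) + m))
    (hl : StrictAnti fun i : Fin (n + 1) => lam i - (i : ℤ) - 1)
    (hli : Finset.image (fun i : Fin (n + 1) => lam i - (i : ℤ) - 1) Finset.univ =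
      Finset.Icc 0 ((n : ℤ) + m) \ Finset.image x Finset.univ)
    (hu : StrictAnti fun i : Fin n => mu i - (i : ℤ) - 1)
    (hui : Finset.image (fun i : Fin n => mu i - (i : ℤ) - 1) Finset.univ =
      Finset.Icc 1 ((n : ℤ) + m) \ Finset.image (fun r => y r + 1) Finset.univ) :
    (∑ i, lam i) - ∑ i, mu i = n + 1 + m - ((∑ i, x i) - ∑ i, y i) := by
  have h1 := Finset.sum_sdiff (f := fun a : ℤ => a) hxA
  have h2 := Finset.sum_sdiff (f := fun a : ℤ => a) hyB
  have hy1 : Function.Injective fun r => y r + 1 := fun a b h => hy (by simpa using h)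
  rw [← hli, Finset.sum_image hl.injective.injOn, Finset.sum_image hx.injOn] at h1
  rw [← hui, Finset.sum_image hu.injective.injOn, Finset.sum_image hy1.injOn] at h2
  have e : Finset.Icc 0 ((n : ℤ) + m) = insert 0 (Finset.Icc 1 ((n : ℤ) + m)) := by
    ext a; simp only [Finset.mem_insert, Finset.mem_Icc]; omega
  rw [e, Finset.sum_insert (by simp)] at h1
  have h3 : ∑ i : Fin (n + 1), ((i : ℕ) : ℤ) = (∑ i : Fin n, ((i : ℕ) : ℤ)) + n := by
    rw [Fin.sum_univ_castSucc]; simp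
  simp only [Finset.sum_sub_distrib, Finset.sum_add_distrib, Finset.sum_const, Finset.card_univ,
    Fintype.card_fin, nsmul_eq_mul, mul_one] at h1 h2
  push_cast at h1 h2
  linarith

theorem pointProd_Icc_zero_eq {q : ℝ} (hq0 : 0 < q) (hq1 : q < 1) {K x y : ℤ} (hx : 0 ≤ x)
    (hxK : x < K) (hy : 0 ≤ y) (hyx : y = x - 1 ∨ y = x) :
    pointProd q (Finset.Icc 0 K) x =
      pointProd q (Finset.Icc 1 K) (y + 1) *
        (q ^ x * (if y = x then 1 else 0) + (1 - q ^ x) * (if y = x - 1 then 1 else 0)) *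
        q ^ (-(K - 1) * (1 - x + y)) * (if y = x then 1 - q ^ (K - x) else 1) := by
  rcases hyx with rfl | rfl
  · rw [pointProd_Icc_zero_of_pos hq0 hq1 (by omega) (by omega)]
    have h : 1 - x + (x - 1) = 0 := by ring
    simp [h]
    ring
  · rw [pointProd_Icc_zero_succ hq0 hq1 hx hxK]
    have h : ¬ y = y - 1 := by omega
    simp [h]
    ring

theorem mul_pairProd_ratio_eq {q : ℝ} (hq0 : 0 < q) (hq1 : q < 1) {m n : ℕ} {x y : Fin m → ℤ}
    (hx : Wm m x) (hy : Wm m y) (hyx : ∀ i, y i = x i - 1 ∨ y i = x i)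
    (hxn : ∀ i, x i < n + m) {lam : Fin (n + 1) → ℤ} {mu : Fin n → ℤ}
    (hl : StrictAnti fun i : Fin (n + 1) => lam i - (i : ℤ) - 1)
    (hli : Finset.image (fun i : Fin (n + 1) => lam i - (i : ℤ) - 1) Finset.univ =
      Finset.Icc 0 ((n : ℤ) + m) \ Finset.image x Finset.univ)
    (hu : StrictAnti fun i : Fin n => mu i - (i : ℤ) - 1)
    (hui : Finset.image (fun i : Fin n => mu i - (i : ℤ) - 1) Finset.univ =
      Finset.Icc 1 ((n : ℤ) + m) \ Finset.image (fun r => y r + 1) Finset.univ) :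
    q ^ ((n : ℤ) * ((∑ i, lam i) - ∑ i, mu i)) *
        (∏ i : Fin n, ∏ j ∈ Finset.Ioi i,
          (q ^ (mu i - (i : ℤ) - 1) - q ^ (mu j - (j : ℤ) - 1)) /
            (q ^ (-(i : ℤ) - 1) - q ^ (-(j : ℤ) - 1))) /
        ∏ i : Fin (n + 1), ∏ j ∈ Finset.Ioi i,
          (q ^ (lam i - (i : ℤ) - 1) - q ^ (lam j - (j : ℤ) - 1)) /
            (q ^ (-(i : ℤ) - 1) - q ^ (-(j : ℤ) - 1)) =
      UpsM q m x y * (∏ i, if y i = x i then 1 - q ^ ((n : ℤ) + m - x i) else 1) /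
        ∏ a ∈ Finset.Icc ((n : ℤ) + 1) (n + m), (1 - q ^ a) := by
  have hq := hq0.ne'
  have hy1 : StrictAnti fun r => y r + 1 := hy.1.add_const 1
  have hxA : Finset.image x Finset.univ ⊆ Finset.Icc 0 ((n : ℤ) + m) := by
    intro a ha
    obtain ⟨i, -, rfl⟩ := Finset.mem_image.1 ha
    exact Finset.mem_Icc.2 ⟨hx.2 i, (hxn i).le⟩
  have hyB : Finset.image (fun r => y r + 1) Finset.univ ⊆ Finset.Icc 1 ((n : ℤ) + m) := by
    intro a ha
    obtain ⟨i, -, rfl⟩ := Finset.mem_image.1 ha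
    have := hy.2 i
    have := hxn i
    exact Finset.mem_Icc.2 ⟨by omega, by rcases hyx i with h | h <;> omega⟩
  have hK : (0 : ℤ) ≤ n + m := by positivity
  have hg (k : ℕ) : StrictAnti fun i : Fin k => -(i : ℤ) - 1 := fun i j hij => by
    have : (i : ℕ) < j := hij
    simp only; omega
  have hV : ∏ i : Fin m, ∏ j ∈ Finset.Ioi i, (q ^ y j - q ^ y i) / (q ^ x j - q ^ x i) =
      pairProd q (Finset.image y Finset.univ) / pairProd q (Finset.image x Finset.univ) := by
    rw [← prod_Ioi_div hq0 hq1 hy.1 hx.1]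
    refine Finset.prod_congr rfl fun i _ => Finset.prod_congr rfl fun j _ => ?_
    rw [← neg_div_neg_eq, neg_sub, neg_sub]
  have hLam := pairProd_sdiff_mul q hxA
  have hMu := pairProd_sdiff_mul q hyB
  rw [Finset.prod_image hx.1.injective.injOn, pairProd_Icc_zero hq0 hq1 hK] at hLam
  rw [Finset.prod_image hy1.injective.injOn, pairProd_image_add_one hq0 hy.1] at hMu
  have hexp : ∑ i, -((n : ℤ) + m - 1) * (1 - x i + y i) =
      -((n : ℤ) + m - 1) * (m - ((∑ i, x i) - ∑ i, y i)) := by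
    rw [← Finset.mul_sum]
    simp only [Finset.sum_sub_distrib, Finset.sum_add_distrib, Finset.sum_const, Finset.card_univ,
      Fintype.card_fin, nsmul_eq_mul, mul_one]
    ring
  rw [Finset.prod_congr rfl fun i _ =>
    pointProd_Icc_zero_eq hq0 hq1 (hx.2 i) (hxn i) (hy.2 i) (hyx i)] at hLam
  simp only [Finset.prod_mul_distrib] at hLam
  rw [prod_zpow_eq_zpow_sum hq, hexp] at hLam
  have hD := pairProd_Ico_neg hq0 hq1 (n := (n : ℤ) + 1) (by omega)
  rw [add_sub_cancel_right] at hD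
  have hQ : ∏ a ∈ Finset.Icc 1 ((n : ℤ) + m), (1 - q ^ a) =
      (∏ a ∈ Finset.Icc 1 (n : ℤ), (1 - q ^ a)) *
        ∏ a ∈ Finset.Icc ((n : ℤ) + 1) (n + m), (1 - q ^ a) := by
    rw [← Finset.prod_union (Finset.disjoint_left.2 fun a ha hb => by
      simp only [Finset.mem_Icc] at ha hb; omega)]
    congr 1
    ext a; simp only [Finset.mem_union, Finset.mem_Icc]; omega
  have hpos (b : ℤ) (hb : 1 ≤ b) (c : ℤ) : 0 < ∏ a ∈ Finset.Icc b c, (1 - q ^ a) :=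
    Finset.prod_pos fun a ha => sub_pos.2
      (zpow_lt_one₀ hq0 hq1 (by have := (Finset.mem_Icc.1 ha).1; omega))
  have hQn := (hpos 1 le_rfl n).ne'
  have hF := (hpos ((n : ℤ) + 1) (by omega) (n + m)).ne'
  have hVX := (pairProd_pos hq0 hq1 (Finset.image x Finset.univ)).ne'
  have hVB := (pairProd_pos hq0 hq1 (Finset.Icc 1 ((n : ℤ) + m))).ne'
  have hVD := (pairProd_pos hq0 hq1 (Finset.Ico (-(n : ℤ)) 0)).ne'
  have hVL := (pairProd_pos hq0 hq1
    (Finset.Icc 0 ((n : ℤ) + m) \ Finset.image x Finset.univ)).ne'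
  have hPB : (∏ i, pointProd q (Finset.Icc 1 ((n : ℤ) + m)) (y i + 1)) ≠ 0 :=
    (Finset.prod_pos fun i _ => pointProd_pos hq0 hq1 _ _).ne'
  rw [prod_Ioi_div hq0 hq1 hu (hg n), prod_Ioi_div hq0 hq1 hl (hg (n + 1)), hli, hui,
    image_neg_sub_one, image_neg_sub_one, UpsM, hV,
    sum_sub_sum_of_image hx.1.injective hy.1.injective hxA hyB hl hli hu hui]
  push_cast
  rw [hD]
  rw [hQ] at hLam
  rw [← UpsInd] at hLam
  have hT : (m : ℤ) * (m - 1) = 2 * ((m : ℤ) * (m - 1) / 2) :=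
    (Int.mul_ediv_cancel' (even_iff_two_dvd.1 (Int.even_mul_pred_self m))).symm
  generalize (m : ℤ) * ((m : ℤ) - 1) / 2 = T at *
  generalize (∑ i, x i) - ∑ i, y i = k at *
  have hpow : q ^ ((n : ℤ) * (n + 1 + m - k)) * q ^ (-(((n : ℤ) + 1) * n)) * q ^ T *
      q ^ (-((n : ℤ) + m - 1) * (m - k)) = q ^ (-T + ((m : ℤ) - 1) * k) := by
    simp only [← zpow_add₀ hq]
    congr 1
    linear_combination -hT
  rw [← hpow]
  generalize q ^ ((n : ℤ) * (n + 1 + m - k)) = p1 at *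
  generalize q ^ (-(((n : ℤ) + 1) * n)) = p2 at *
  generalize q ^ T = p3 at *
  generalize q ^ (-((n : ℤ) + m - 1) * (m - k)) = p4 at *
  generalize pairProd q (Finset.Icc 1 ((n : ℤ) + m) \ _) = VM at *
  generalize pairProd q (Finset.Icc 0 ((n : ℤ) + m) \ _) = VL at *
  generalize pairProd q (Finset.Icc 1 ((n : ℤ) + m)) = VB at *
  generalize pairProd q (Finset.Ico (-(n : ℤ)) 0) = D at *
  generalize pairProd q (Finset.image x Finset.univ) = VX at *
  generalize pairProd q (Finset.image y Finset.univ) = VY at *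
  generalize ∏ i, pointProd q (Finset.Icc 1 ((n : ℤ) + m)) (y i + 1) = PB at *
  generalize (∏ a ∈ Finset.Icc 1 (n : ℤ), (1 - q ^ a)) = Qn at *
  generalize (∏ a ∈ Finset.Icc ((n : ℤ) + 1) (n + m), (1 - q ^ a)) = F at *
  generalize (∏ i, if y i = x i then 1 - q ^ ((n : ℤ) + m - x i) else 1) = E at *
  generalize UpsInd q m x y = U at *
  have hVM : VM = VB * (p3 * VY) / PB := by rw [eq_div_iff hPB]; exact hMu
  rw [hVM]
  field_simp
  linear_combination (-VY) * p1 * p2 * p3 * hLam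

/-- The ratio of principally specialized Schur polynomials, i.e. the conditional
probability `𝒯_N^{(λ)}(Λ^{(N−1)} = μ)` of the `q^{−volume}` measure, converges to the
transition probability `Υ_m(x,y)` of the noncolliding `q`-exchangeable walks, where
`λ = λ(N)` and `μ = μ(N−1)` encode `x` and `y` via their particle coordinates. -/
theorem stmt_18 (q : ℝ) (hq0 : 0 < q) (hq1 : q < 1) (m : ℕ) (hm : 1 ≤ m)
    (x y : Fin m → ℤ) (hx : Wm m x) (hy : Wm m y)
    (hyx : ∀ i, y i = x i - 1 ∨ y i = x i)
    (lam : (N : ℕ) → Fin N → ℤ) (mu : (N : ℕ) → Fin N → ℤ)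
    (hlam : ∀ᶠ N : ℕ in Filter.atTop,
        (StrictAnti fun i : Fin N => lam N i - (i : ℤ) - 1) ∧
        Finset.image (fun i : Fin N => lam N i - (i : ℤ) - 1) Finset.univ
          = Finset.image (fun n : ℕ => (n : ℤ)) (Finset.range (N + m)) \
              Finset.image x Finset.univ)
    (hmu : ∀ᶠ N : ℕ in Filter.atTop,
        (StrictAnti fun i : Fin (N - 1) => mu (N - 1) i - (i : ℤ) - 1) ∧
        Finset.image (fun i : Fin (N - 1) => mu (N - 1) i - (i : ℤ) - 1) Finset.univ
          = Finset.Icc (1 : ℤ) ((N : ℤ) + m - 1) \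
              Finset.image (fun r => y r + 1) Finset.univ) :
    Filter.Tendsto (fun N : ℕ =>
        q ^ (((N : ℤ) - 1) * ((∑ i, lam N i) - ∑ i, mu (N - 1) i)) *
          (∏ i : Fin (N - 1), ∏ j ∈ Finset.Ioi i,
              (q ^ (mu (N - 1) i - (i : ℤ) - 1) - q ^ (mu (N - 1) j - (j : ℤ) - 1)) /
                (q ^ (-(i : ℤ) - 1) - q ^ (-(j : ℤ) - 1))) /
          ∏ i : Fin N, ∏ j ∈ Finset.Ioi i,
              (q ^ (lam N i - (i : ℤ) - 1) - q ^ (lam N j - (j : ℤ) - 1)) /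
                (q ^ (-(i : ℤ) - 1) - q ^ (-(j : ℤ) - 1)))
      Filter.atTop (nhds (UpsM q m x y)) := by
  have hlim : Filter.Tendsto (fun N : ℕ => UpsM q m x y *
      (∏ i, if y i = x i then 1 - q ^ ((N : ℤ) - 1 + m - x i) else 1) /
        ∏ j ∈ Finset.range m, (1 - q ^ ((N : ℤ) + j))) Filter.atTop (nhds (UpsM q m x y)) := by
    have h0 (c : ℤ) : Filter.Tendsto (fun N : ℕ => 1 - q ^ ((N : ℤ) + c)) Filter.atTop (nhds 1) := by
      have := ((tendsto_pow_atTop_nhds_zero_of_lt_one hq0.le hq1).mul_const (q ^ c)).const_sub 1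
      simpa [zpow_add₀ hq0.ne'] using this
    have h1 : Filter.Tendsto (fun N : ℕ =>
        ∏ i, if y i = x i then 1 - q ^ ((N : ℤ) - 1 + m - x i) else 1) Filter.atTop (nhds 1) := by
      rw [show nhds (1 : ℝ) = nhds (∏ _i : Fin m, 1) by rw [Finset.prod_const_one]]
      refine tendsto_finsetProd _ fun i _ => ?_
      split_ifs
      · refine (h0 (-1 + m - x i)).congr fun N => ?_
        congr 2; ring
      · exact tendsto_const_nhds
    have h2 : Filter.Tendsto (fun N : ℕ => ∏ j ∈ Finset.range m, (1 - q ^ ((N : ℤ) + j)))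
        Filter.atTop (nhds 1) := by
      rw [show nhds (1 : ℝ) = nhds (∏ _j ∈ Finset.range m, 1) by rw [Finset.prod_const_one]]
      exact tendsto_finsetProd _ fun j _ => h0 j
    have h3 := (h1.const_mul (UpsM q m x y)).div h2 one_ne_zero
    rw [mul_one, div_one] at h3
    exact h3
  refine hlim.congr' ?_
  have hbig : ∀ᶠ N : ℕ in Filter.atTop, ∀ i, x i < (N : ℤ) :=
    Filter.eventually_all.2 fun i => by
      filter_upwards [Filter.eventually_gt_atTop (x i).toNat] with N hN
      omega
  filter_upwards [hlam, hmu, hbig, Filter.eventually_ge_atTop 1] with N hl hu hxN hN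
  obtain ⟨n, rfl⟩ : ∃ n, N = n + 1 := ⟨N - 1, by omega⟩
  have hA : Finset.image (fun k : ℕ => (k : ℤ)) (Finset.range (n + 1 + m)) =
      Finset.Icc 0 ((n : ℤ) + m) := by
    ext a
    simp only [Finset.mem_image, Finset.mem_range, Finset.mem_Icc]
    constructor
    · rintro ⟨k, hk, rfl⟩; omega
    · intro h; exact ⟨a.toNat, by omega, by omega⟩
  have hB : (((n + 1 : ℕ) : ℤ) + m - 1) = n + m := by push_cast; ring
  have hF : ∏ a ∈ Finset.Icc ((n : ℤ) + 1) (n + m), (1 - q ^ a) =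
      ∏ j ∈ Finset.range m, (1 - q ^ (((n + 1 : ℕ) : ℤ) + j)) := by
    have e : Finset.Icc ((n : ℤ) + 1) (n + m) =
        (Finset.range m).image fun j : ℕ => ((n + 1 : ℕ) : ℤ) + j := by
      ext a
      simp only [Finset.mem_image, Finset.mem_range, Finset.mem_Icc]
      constructor
      · intro h; exact ⟨(a - n - 1).toNat, by omega, by omega⟩
      · rintro ⟨k, hk, rfl⟩; omega
    rw [e, Finset.prod_image fun a _ b _ h => by simpa using h]
  rw [hA] at hl
  rw [hB] at hu
  have key := mul_pairProd_ratio_eq hq0 hq1 hx hy hyx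
    (fun i => by have := hxN i; push_cast at this; omega) hl.1 hl.2 hu.1 hu.2
  rw [hF] at key
  have hn : ((n + 1 : ℕ) : ℤ) - 1 = n := by push_cast; ring
  rw [hn]
  exact key.symm
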